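/- Let k ≥ 2 and N ≥ 1 be integers. For all real numbers 0 < z ≤ z' one has φ_N(z') ≤ (z'/z)·φ_N(z). Consequently, for any 0 < z₁ ≤ z₂, the function φ_N is Lipschitz on [z₁,z₂] with |φ_N(z') − φ_N(z)| ≤ m_k·z₂^{1/k}·z₁^{−1}·|z' − z| for all z, z' ∈ [z₁,z₂]. -/

import Mathlib

open Real Filter Topology Set MeasureTheory intervalIntegral

/-- `φ_N(z)`: infimum of `T + ∫_0^T |v^{(k)}|²` over `T > 0` and `C^k` functions with
`v(T) - v(0) = z` and `|v^{(ℓ)}(0)|, |v^{(ℓ)}(T)| ≤ 1/N` for all `ℓ ∈ {1,…,k-1}`. -/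
noncomputable def phiN (k N : ℕ) (z : ℝ) : ℝ :=
  sInf {E : ℝ | ∃ T : ℝ, 0 < T ∧ ∃ v : ℝ → ℝ, ContDiff ℝ (k : ℕ∞) v ∧
    v T - v 0 = z ∧
    (∀ ℓ : ℕ, 1 ≤ ℓ → ℓ ≤ k - 1 →
      |iteratedDeriv ℓ v 0| ≤ 1 / (N:ℝ) ∧ |iteratedDeriv ℓ v T| ≤ 1 / (N:ℝ)) ∧
    E = T + ∫ t in (0:ℝ)..T, (iteratedDeriv k v t) ^ 2}

/-- `m_k`: infimum of `T + ∫_0^T |v^{(k)}|²` over `T > 0` and `C^k` functions with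
`v(0) = 0`, `v(T) = 1`, and `v^{(ℓ)}(0) = v^{(ℓ)}(T) = 0` for all `ℓ ∈ {1,…,k-1}`. -/
noncomputable def mkConst (k : ℕ) : ℝ :=
  sInf {E : ℝ | ∃ T : ℝ, 0 < T ∧ ∃ v : ℝ → ℝ, ContDiff ℝ (k : ℕ∞) v ∧
    v 0 = 0 ∧ v T = 1 ∧
    (∀ ℓ : ℕ, 1 ≤ ℓ → ℓ ≤ k - 1 →
      iteratedDeriv ℓ v 0 = 0 ∧ iteratedDeriv ℓ v T = 0) ∧
    E = T + ∫ t in (0:ℝ)..T, (iteratedDeriv k v t) ^ 2}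

/-- The derivatives of the rescaled function `t ↦ a * v (t / s)`. -/
theorem iteratedDeriv_rescale {n : ℕ} {v : ℝ → ℝ} (hv : ContDiff ℝ n v) (a s t : ℝ) :
    iteratedDeriv n (fun x => a * v (s⁻¹ * x)) t
      = a * s⁻¹ ^ n * iteratedDeriv n v (s⁻¹ * t) := by
  rw [iteratedDeriv_const_mul_field, iteratedDeriv_comp_const_mul hv, mul_assoc]

/-- The energy of the rescaled function `t ↦ a * v (t / s)` on `[0, s * T]`. -/
theorem integral_sq_iteratedDeriv_rescale {k : ℕ} {v : ℝ → ℝ} (hv : ContDiff ℝ k v)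
    (a T : ℝ) {s : ℝ} (hs : 0 < s) :
    ∫ t in (0:ℝ)..(s * T), (iteratedDeriv k (fun x => a * v (s⁻¹ * x)) t) ^ 2
      = a ^ 2 * s⁻¹ ^ (2 * k) * s * ∫ t in (0:ℝ)..T, (iteratedDeriv k v t) ^ 2 := by
  simp only [iteratedDeriv_rescale hv, mul_pow]
  rw [intervalIntegral.integral_const_mul,
    intervalIntegral.integral_comp_mul_left (fun t => iteratedDeriv k v t ^ 2)
      (inv_ne_zero hs.ne'), mul_zero, inv_mul_cancel_left₀ hs.ne', inv_inv, smul_eq_mul]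
  ring

theorem energy_nonneg (k : ℕ) (v : ℝ → ℝ) {T : ℝ} (hT : 0 < T) :
    0 ≤ T + ∫ t in (0:ℝ)..T, (iteratedDeriv k v t) ^ 2 :=
  add_nonneg hT.le (intervalIntegral.integral_nonneg hT.le fun _ _ => sq_nonneg _)

theorem phiN_le {k N : ℕ} {z T : ℝ} (hT : 0 < T) {v : ℝ → ℝ} (hv : ContDiff ℝ (k : ℕ∞) v)
    (hz : v T - v 0 = z)
    (hb : ∀ ℓ : ℕ, 1 ≤ ℓ → ℓ ≤ k - 1 →
      |iteratedDeriv ℓ v 0| ≤ 1 / (N:ℝ) ∧ |iteratedDeriv ℓ v T| ≤ 1 / (N:ℝ)) :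
    phiN k N z ≤ T + ∫ t in (0:ℝ)..T, (iteratedDeriv k v t) ^ 2 := by
  refine csInf_le ⟨0, ?_⟩ ⟨T, hT, v, hv, hz, hb, rfl⟩
  rintro E ⟨T, hT, v, -, -, -, rfl⟩
  exact energy_nonneg k v hT

/-- A smooth step whose derivatives all vanish at the end points of `[0, 3]`. -/
theorem exists_smooth_step (k : ℕ) :
    ∃ T : ℝ, 0 < T ∧ ∃ v : ℝ → ℝ, ContDiff ℝ (k : ℕ∞) v ∧ v 0 = 0 ∧ v T = 1 ∧
      ∀ ℓ : ℕ, 1 ≤ ℓ → ℓ ≤ k - 1 → iteratedDeriv ℓ v 0 = 0 ∧ iteratedDeriv ℓ v T = 0 := by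
  have h0 : (fun t : ℝ => Real.smoothTransition (t - 1)) =ᶠ[𝓝 0] fun _ => 0 := by
    filter_upwards [Iio_mem_nhds (zero_lt_one' ℝ)] with t ht
    exact Real.smoothTransition.zero_of_nonpos (by linarith [mem_Iio.mp ht])
  have h3 : (fun t : ℝ => Real.smoothTransition (t - 1)) =ᶠ[𝓝 3] fun _ => 1 := by
    filter_upwards [Ioi_mem_nhds (show (2:ℝ) < 3 by norm_num)] with t ht
    exact Real.smoothTransition.one_of_one_le (by linarith [mem_Ioi.mp ht])
  refine ⟨3, by norm_num, fun t => Real.smoothTransition (t - 1),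
    Real.smoothTransition.contDiff.comp (contDiff_id.sub contDiff_const),
    h0.eq_of_nhds, h3.eq_of_nhds, fun ℓ hℓ _ => ⟨?_, ?_⟩⟩
  · rw [h0.iteratedDeriv_eq, iteratedDeriv_const, if_neg (by omega)]
  · rw [h3.iteratedDeriv_eq, iteratedDeriv_const, if_neg (by omega)]

theorem mkConst_nonneg (k : ℕ) : 0 ≤ mkConst k := by
  refine Real.sInf_nonneg ?_
  rintro E ⟨T, hT, v, -, -, -, -, rfl⟩
  exact energy_nonneg k v hT

theorem exists_phiN_competitor (k N : ℕ) (z : ℝ) :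
    ∃ T : ℝ, 0 < T ∧ ∃ v : ℝ → ℝ, ContDiff ℝ (k : ℕ∞) v ∧ v T - v 0 = z ∧
      ∀ ℓ : ℕ, 1 ≤ ℓ → ℓ ≤ k - 1 →
        |iteratedDeriv ℓ v 0| ≤ 1 / (N:ℝ) ∧ |iteratedDeriv ℓ v T| ≤ 1 / (N:ℝ) := by
  obtain ⟨T, hT, v, hv, h0, h1, hd⟩ := exists_smooth_step k
  refine ⟨T, hT, fun t => z * v t, contDiff_const.mul hv, by simp [h0, h1], fun ℓ hℓ hℓk => ?_⟩
  rw [iteratedDeriv_const_mul_field, iteratedDeriv_const_mul_field,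
    (hd ℓ hℓ hℓk).1, (hd ℓ hℓ hℓk).2]
  simp

/-- Scaling values by `a` and time by `s` compares the values of `phiN`. -/
theorem phiN_mul_le {k N : ℕ} (z : ℝ) {a s C : ℝ} (ha : 0 ≤ a) (hs : 1 ≤ s) (has : a ≤ s)
    (hsC : s ≤ C) (haC : a ^ 2 * s⁻¹ ^ (2 * k) * s ≤ C) :
    phiN k N (a * z) ≤ C * phiN k N z := by
  have hs0 : 0 < s := by linarith
  have hC0 : 0 < C := by linarith
  have hfac : ∀ ℓ : ℕ, 1 ≤ ℓ → |a * s⁻¹ ^ ℓ| ≤ 1 := fun ℓ hℓ => by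
    rw [abs_of_nonneg (by positivity)]
    calc a * s⁻¹ ^ ℓ ≤ s * s⁻¹ ^ 1 := by
          exact mul_le_mul has
            (pow_le_pow_of_le_one (by positivity) (inv_le_one_of_one_le₀ hs) hℓ)
            (by positivity) hs0.le
      _ = 1 := by rw [pow_one, mul_inv_cancel₀ hs0.ne']
  rw [← div_le_iff₀' hC0]
  obtain ⟨T, hT, v, hv, hz, hb⟩ := exists_phiN_competitor k N z
  refine le_csInf ⟨_, T, hT, v, hv, hz, hb, rfl⟩ ?_
  rintro E ⟨T, hT, v, hv, rfl, hb, rfl⟩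
  rw [div_le_iff₀' hC0]
  have hbound : ∀ ℓ : ℕ, 1 ≤ ℓ → ∀ y : ℝ, |y| ≤ 1 / (N:ℝ) → |a * s⁻¹ ^ ℓ * y| ≤ 1 / (N:ℝ) :=
    fun ℓ hℓ y hy => by
      rw [abs_mul]
      exact (mul_le_of_le_one_left (abs_nonneg y) (hfac ℓ hℓ)).trans hy
  refine (phiN_le (T := s * T) (v := fun x => a * v (s⁻¹ * x)) (by positivity)
    (contDiff_const.mul (hv.comp (contDiff_const.mul contDiff_id))) ?_ ?_).trans ?_
  · simp only [inv_mul_cancel_left₀ hs0.ne', mul_zero]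
    ring
  · intro ℓ hℓ hℓk
    have hvℓ : ContDiff ℝ ℓ v := hv.of_le (by exact_mod_cast (by omega : ℓ ≤ k))
    rw [iteratedDeriv_rescale hvℓ, iteratedDeriv_rescale hvℓ, mul_zero,
      inv_mul_cancel_left₀ hs0.ne']
    exact ⟨hbound ℓ hℓ _ (hb ℓ hℓ hℓk).1, hbound ℓ hℓ _ (hb ℓ hℓ hℓk).2⟩
  · rw [integral_sq_iteratedDeriv_rescale (mod_cast hv) a T hs0, mul_add]
    have hI : 0 ≤ ∫ t in (0:ℝ)..T, (iteratedDeriv k v t) ^ 2 :=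
      intervalIntegral.integral_nonneg hT.le fun _ _ => sq_nonneg _
    gcongr

theorem phiN_le_div_mul {k N : ℕ} (hk : 1 ≤ k) {z z' : ℝ} (hz : 0 < z) (h : z ≤ z') :
    phiN k N z' ≤ (z' / z) * phiN k N z := by
  have hs : 1 ≤ z' / z := (one_le_div hz).mpr h
  have hs0 : 0 < z' / z := by linarith
  have key := phiN_mul_le (k := k) (N := N) z hs0.le hs le_rfl le_rfl (by
    refine mul_le_of_le_one_left hs0.le ?_
    calc (z' / z) ^ 2 * (z' / z)⁻¹ ^ (2 * k) ≤ (z' / z) ^ 2 * (z' / z)⁻¹ ^ 2 := by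
          refine mul_le_mul_of_nonneg_left ?_ (by positivity)
          exact pow_le_pow_of_le_one (by positivity) (inv_le_one_of_one_le₀ hs) (by omega)
      _ = 1 := by rw [← mul_pow, mul_inv_cancel₀ hs0.ne', one_pow])
  rwa [div_mul_cancel₀ _ hz.ne'] at key

theorem phiN_mono {k N : ℕ} {z z' : ℝ} (hz : 0 < z) (h : z ≤ z') :
    phiN k N z ≤ phiN k N z' := by
  have hz' : 0 < z' := hz.trans_le h
  have ha : z / z' ≤ 1 := (div_le_one hz').mpr h
  have ha0 : 0 ≤ z / z' := by positivity
  have key := phiN_mul_le (k := k) (N := N) z' ha0 le_rfl ha le_rfl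
    (by simpa only [inv_one, one_pow, mul_one] using pow_le_one₀ ha0 ha)
  rwa [div_mul_cancel₀ _ hz'.ne', one_mul] at key

theorem phiN_le_mkConst_mul {k N : ℕ} (hk : 1 ≤ k) {z : ℝ} (hz : 0 < z) :
    phiN k N z ≤ mkConst k * z ^ ((1:ℝ) / (k:ℝ)) := by
  set s := z ^ ((1:ℝ) / (k:ℝ)) with hs
  have hs0 : 0 < s := Real.rpow_pos_of_pos hz _
  have hsk : s ^ k = z := by
    rw [hs, one_div, Real.rpow_inv_natCast_pow hz.le (by omega)]
  rw [← div_le_iff₀ hs0]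
  obtain ⟨T, hT, v, hv, h0, h1, hd⟩ := exists_smooth_step k
  refine le_csInf ⟨_, T, hT, v, hv, h0, h1, hd, rfl⟩ ?_
  rintro E ⟨T, hT, v, hv, h0, h1, hd, rfl⟩
  rw [div_le_iff₀ hs0]
  refine (phiN_le (T := s * T) (v := fun x => z * v (s⁻¹ * x)) (by positivity)
    (contDiff_const.mul (hv.comp (contDiff_const.mul contDiff_id))) ?_ ?_).trans_eq ?_
  · simp [inv_mul_cancel_left₀ hs0.ne', h0, h1]
  · intro ℓ hℓ hℓk
    have hvℓ : ContDiff ℝ ℓ v := hv.of_le (by exact_mod_cast (by omega : ℓ ≤ k))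
    rw [iteratedDeriv_rescale hvℓ, iteratedDeriv_rescale hvℓ, mul_zero,
      inv_mul_cancel_left₀ hs0.ne', (hd ℓ hℓ hℓk).1, (hd ℓ hℓ hℓk).2]
    simp
  · have hone : z ^ 2 * s⁻¹ ^ (2 * k) = 1 := by
      rw [inv_pow, mul_comm 2 k, pow_mul, hsk, mul_inv_cancel₀ (by positivity)]
    rw [integral_sq_iteratedDeriv_rescale (mod_cast hv) z T hs0, hone]
    ring

theorem stmt_11 (k N : ℕ) (hk : 2 ≤ k) (hN : 1 ≤ N) :
    (∀ z z' : ℝ, 0 < z → z ≤ z' → phiN k N z' ≤ (z' / z) * phiN k N z) ∧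
    (∀ z₁ z₂ : ℝ, 0 < z₁ → z₁ ≤ z₂ → ∀ z ∈ Set.Icc z₁ z₂, ∀ z' ∈ Set.Icc z₁ z₂,
      |phiN k N z' - phiN k N z| ≤ mkConst k * z₂ ^ ((1:ℝ)/(k:ℝ)) * z₁⁻¹ * |z' - z|) := by
  refine ⟨fun z z' hz h => phiN_le_div_mul (by omega) hz h, fun z₁ z₂ hz₁ _ => ?_⟩
  have ordered : ∀ z ∈ Set.Icc z₁ z₂, ∀ z' ∈ Set.Icc z₁ z₂, z ≤ z' →
      |phiN k N z' - phiN k N z| ≤ mkConst k * z₂ ^ ((1:ℝ)/(k:ℝ)) * z₁⁻¹ * |z' - z| := by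
    intro z hz z' _ h
    have hz0 : 0 < z := hz₁.trans_le hz.1
    have hd : 0 ≤ z' - z := sub_nonneg.mpr h
    have hm := mkConst_nonneg k
    rw [abs_of_nonneg (sub_nonneg.mpr (phiN_mono hz0 h)), abs_of_nonneg hd]
    calc phiN k N z' - phiN k N z ≤ z' / z * phiN k N z - phiN k N z :=
          sub_le_sub_right (phiN_le_div_mul (by omega) hz0 h) _
      _ = phiN k N z * (z⁻¹ * (z' - z)) := by field_simp
      _ ≤ mkConst k * z ^ ((1:ℝ)/(k:ℝ)) * (z⁻¹ * (z' - z)) := by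
          gcongr
          exact phiN_le_mkConst_mul (by omega) hz0
      _ ≤ mkConst k * z₂ ^ ((1:ℝ)/(k:ℝ)) * (z₁⁻¹ * (z' - z)) := by
          gcongr
          · have := hz₁.le.trans (hz.1.trans hz.2)
            positivity
          · exact hz.2
          · exact hz.1
      _ = _ := by ring
  intro z hz z' hz'
  rcases le_total z z' with h | h
  · exact ordered z hz z' hz' h
  · rw [abs_sub_comm, abs_sub_comm z' z]
    exact ordered z' hz' z hz h
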